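/- The conditionally convergent series E_2(ℓ,ℓ') := ∑_{n≠0} (nℓ)^{-2} + ∑_{n≠0} ∑_{m∈ℤ} (mℓ + nℓ')^{-2} (inner sum over m first, then over n) converges for every lattice basis (ℓ,ℓ') with ℓ/ℓ' in the upper half plane, and satisfies the homogeneity E_2(μℓ, μℓ') = μ^{-2} E_2(ℓ,ℓ') for all μ ∈ ℂ^×. -/

import Mathlib

open Complex

/-- The second Eisenstein series `E₂(ℓ,ℓ')` defined by the conditionally convergent
ordered sum `∑_{n≠0} (nℓ)⁻² + ∑_{n≠0} ∑_{m∈ℤ} (mℓ + nℓ')⁻²` (inner sum over `m` first,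
then over `n`). -/
noncomputable def EisensteinTwo (ℓ ℓ' : ℂ) : ℂ :=
  (∑' n : {n : ℤ // n ≠ 0}, (((n.1 : ℂ) * ℓ) ^ 2)⁻¹) +
    ∑' n : {n : ℤ // n ≠ 0}, ∑' m : ℤ, (((m : ℂ) * ℓ + (n.1 : ℂ) * ℓ') ^ 2)⁻¹

open EisensteinSeries in
/-- The inner sums of the Eisenstein series of weight two are absolutely summable over `ℤ`. -/
lemma summable_e2Summand (z : UpperHalfPlane) : Summable fun n : ℤ => e2Summand n z := by
  have hpos : Summable fun n : ℕ+ => e2Summand ((n : ℕ) : ℤ) z := by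
    have hq : ‖cexp (2 * Real.pi * I * z)‖ < 1 :=
      UpperHalfPlane.norm_exp_two_pi_I_lt_one z
    refine ((summable_prod_mul_pow 1 hq).prod.mul_left
      ((-2 * Real.pi * I) ^ 2 / (Nat.factorial 1 : ℂ))).congr fun n => ?_
    have H := qExpansion_identity_pnat (k := 1) le_rfl
      ⟨n * z, by simpa using z.2⟩
    calc _ = ∑' m : ℤ, 1 / ((n : ℂ) * z + m) ^ 2 := by
          refine Eq.trans ?_ H.symm
          congr 1
          refine tsum_congr fun m => ?_
          rw [pow_mul, ← Complex.exp_nat_mul _ (n : ℕ)]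
          congr 3
          push_cast
          ring
      _ = _ := by simp [e2Summand, eisSummand, zpow_ofNat]
  have hnat : Summable fun n : ℕ => e2Summand (n : ℤ) z :=
    summable_pnat_iff_summable_nat.mp hpos
  exact hnat.of_nat_of_neg (by simpa only [e2Summand_even z _] using hnat)

lemma inv_sq_mul_add_mul (μ ℓ ℓ' a b : ℂ) :
    ((a * (μ * ℓ) + b * (μ * ℓ')) ^ 2)⁻¹ = (μ ^ 2)⁻¹ * ((a * ℓ + b * ℓ') ^ 2)⁻¹ := by
  rw [← mul_inv, ← mul_pow]
  ring_nf

/-- Homogeneity holds termwise, without any convergence assumption. -/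
lemma EisensteinTwo_mul (μ ℓ ℓ' : ℂ) :
    EisensteinTwo (μ * ℓ) (μ * ℓ') = (μ ^ 2)⁻¹ * EisensteinTwo ℓ ℓ' := by
  have h (a : ℂ) : ((a * (μ * ℓ)) ^ 2)⁻¹ = (μ ^ 2)⁻¹ * ((a * ℓ) ^ 2)⁻¹ := by
    simpa using inv_sq_mul_add_mul μ ℓ ℓ' a 0
  simp only [EisensteinTwo, inv_sq_mul_add_mul, h, tsum_mul_left, mul_add]

/-- For every oriented lattice basis `(ℓ,ℓ')` with `ℓ/ℓ'` in the upper
half plane, the conditionally convergent series defining `E₂(ℓ,ℓ')` converges (each of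
the constituent sums, in the specified order, is summable), and `E₂` satisfies the
homogeneity `E₂(μℓ, μℓ') = μ⁻² E₂(ℓ,ℓ')` for all `μ ∈ ℂˣ`. -/
theorem elliptic_MQ_stmt7 (ℓ ℓ' : ℂ) (h : 0 < (ℓ / ℓ').im) :
    Summable (fun n : {n : ℤ // n ≠ 0} => (((n.1 : ℂ) * ℓ) ^ 2)⁻¹) ∧
    (∀ n : {n : ℤ // n ≠ 0},
      Summable (fun m : ℤ => (((m : ℂ) * ℓ + (n.1 : ℂ) * ℓ') ^ 2)⁻¹)) ∧
    Summable (fun n : {n : ℤ // n ≠ 0} =>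
      ∑' m : ℤ, (((m : ℂ) * ℓ + (n.1 : ℂ) * ℓ') ^ 2)⁻¹) ∧
    (∀ μ : ℂ, μ ≠ 0 → EisensteinTwo (μ * ℓ) (μ * ℓ') = (μ ^ 2)⁻¹ * EisensteinTwo ℓ ℓ') := by
  have hℓ : ℓ ≠ 0 := by rintro rfl; simp at h
  have hz : 0 < (-ℓ' / ℓ).im := by
    rw [neg_div, ← inv_div, neg_im, inv_im, neg_div, neg_neg]
    exact div_pos h (normSq_pos.mpr fun h0 => by simp [h0] at h)
  let z : UpperHalfPlane := ⟨-ℓ' / ℓ, hz⟩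
  have hzℓ : ℓ * z = -ℓ' := mul_div_cancel₀ _ hℓ
  have hterm (n m : ℤ) : (((m : ℂ) * ℓ + (n : ℂ) * ℓ') ^ 2)⁻¹ =
      (ℓ ^ 2)⁻¹ * EisensteinSeries.eisSummand 2 ![-n, m] z := by
    have : (m : ℂ) * ℓ + (n : ℂ) * ℓ' = ℓ * (((-n : ℤ) : ℂ) * z + m) := by
      push_cast
      linear_combination (n : ℂ) * hzℓ
    rw [this, mul_pow, mul_inv]
    simp [EisensteinSeries.eisSummand, zpow_ofNat]
  refine ⟨?_, fun n => ?_, ?_, fun μ _ => EisensteinTwo_mul μ ℓ ℓ'⟩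
  · have := (EisensteinSeries.linear_left_summable hℓ 0 (k := 2) le_rfl).subtype {n : ℤ | n ≠ 0}
    simpa [Function.comp_def, zpow_ofNat] using! this
  · simp only [hterm]
    exact (EisensteinSeries.e2Summand_summable _ z).mul_left _
  · simp only [hterm, tsum_mul_left]
    exact (((summable_e2Summand z).comp_injective neg_injective).subtype {n : ℤ | n ≠ 0}).mul_left _
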